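/- Let n ≥ 2 be an integer and let α be a nonzero element of the subfield ℂ(x₂,…,xₙ) of ℂ(x₁,…,x_{n+1}). Then the automorphism of ℂ(x₁,…,x_{n+1}) over ℂ determined by x₁ ↦ α·x₁ and xᵢ ↦ xᵢ for all i ≥ 2 lies in the commutator subgroup of Cr_{n+1}(ℂ); in particular, its image in the abelianization of Cr_{n+1}(ℂ) is trivial. -/

import Mathlib

/-!
Let `n ≥ 2` and let `α` be a nonzero element of the subfield `ℂ(x₂, …, xₙ)` of
`ℂ(x₁, …, x_{n+1})`. Then the automorphism of `ℂ(x₁, …, x_{n+1})` over `ℂ` determined by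
`x₁ ↦ α·x₁` and `xᵢ ↦ xᵢ` for `i ≥ 2` lies in the commutator subgroup of `Cr_{n+1}(ℂ)`;
in particular its image in the abelianization of `Cr_{n+1}(ℂ)` is trivial.
-/

open MvPolynomial

noncomputable section

set_option maxHeartbeats 1000000
set_option synthInstance.maxHeartbeats 400000

/-- The rational function field `K(x₁, …, xₙ)`. -/
abbrev RatFun (K : Type) [Field K] (n : ℕ) : Type := FractionRing (MvPolynomial (Fin n) K)

/-- The inclusion of variable indices realizing `{x₂, …, xₙ} ⊆ {x₁, …, x_{n+1}}`
(zero-indexed: the `j`-th variable goes to the `(j+1)`-st variable of `Fin (n+1)`). -/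
def midIdx (n : ℕ) (j : Fin (n - 1)) : Fin (n + 1) := ⟨j.1 + 1, by omega⟩

lemma midIdx_injective (n : ℕ) : Function.Injective (midIdx n) := by
  intro j₁ j₂ h
  exact Fin.ext (by simpa [midIdx] using h)

/-- The embedding of the subfield `K(x₂, …, xₙ)` into `K(x₁, …, x_{n+1})`, induced by the
inclusion of the corresponding set of variables. -/
def midEmb (K : Type) [Field K] (n : ℕ) : RatFun K (n - 1) →ₐ[K] RatFun K (n + 1) :=
  IsFractionRing.liftAlgHom (R := K)
    (g := (IsScalarTower.toAlgHom K (MvPolynomial (Fin (n+1)) K) (RatFun K (n+1))).comp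
      (MvPolynomial.rename (midIdx n)))
    (by
      exact (IsFractionRing.injective (MvPolynomial (Fin (n+1)) K) (RatFun K (n+1))).comp
        (MvPolynomial.rename_injective _ (midIdx_injective n)))

/-- The `i`-th variable, as an element of the rational function field. -/
abbrev RatFun.X {K : Type} [Field K] {n : ℕ} (i : Fin n) : RatFun K n :=
  algebraMap (MvPolynomial (Fin n) K) (RatFun K n) (MvPolynomial.X i)

/-- The rational functions that do not involve the variables outside `s`. -/
abbrev RatFun.adjoinVars (K : Type) [Field K] {n : ℕ} (s : Set (Fin n)) :
    IntermediateField K (RatFun K n) :=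
  IntermediateField.adjoin K (RatFun.X '' s)

lemma algebraMap_rename_mem_adjoinVars (K : Type) [Field K] {m n : ℕ} (f : Fin m → Fin n)
    (p : MvPolynomial (Fin m) K) :
    algebraMap (MvPolynomial (Fin n) K) (RatFun K n) (rename f p) ∈
      RatFun.adjoinVars K (Set.range f) := by
  induction p using MvPolynomial.induction_on with
  | C a =>
    rw [rename_C, ← MvPolynomial.algebraMap_eq, ← IsScalarTower.algebraMap_apply]
    exact IntermediateField.algebraMap_mem _ a
  | add p q hp hq =>
    rw [map_add, map_add]
    exact add_mem hp hq
  | mul_X p i hp =>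
    rw [map_mul, map_mul, rename_X]
    exact mul_mem hp (IntermediateField.subset_adjoin _ _ ⟨f i, ⟨i, rfl⟩, rfl⟩)

lemma RatFun.adjoinVars_univ (K : Type) [Field K] (n : ℕ) :
    RatFun.adjoinVars K (Set.univ : Set (Fin n)) = ⊤ := by
  refine eq_top_iff.2 fun x _ => ?_
  obtain ⟨p, q, -, rfl⟩ := IsFractionRing.div_surjective (A := MvPolynomial (Fin n) K) x
  have h (p : MvPolynomial (Fin n) K) := algebraMap_rename_mem_adjoinVars K id p
  simp only [rename_id_apply, Set.range_id] at h
  exact div_mem (h p) (h q)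

lemma midEmb_mem_adjoinVars (K : Type) [Field K] (n : ℕ) (x : RatFun K (n - 1)) :
    midEmb K n x ∈ RatFun.adjoinVars K (Set.range (midIdx n)) := by
  obtain ⟨p, q, -, rfl⟩ := IsFractionRing.div_surjective (A := MvPolynomial (Fin (n - 1)) K) x
  have h (p : MvPolynomial (Fin (n - 1)) K) :
      midEmb K n (algebraMap _ _ p) ∈ RatFun.adjoinVars K (Set.range (midIdx n)) := by
    have hp : midEmb K n (algebraMap _ _ p) =
        algebraMap (MvPolynomial (Fin (n + 1)) K) (RatFun K (n + 1)) (rename (midIdx n) p) :=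
      IsFractionRing.lift_algebraMap
        (g := ((IsScalarTower.toAlgHom K (MvPolynomial (Fin (n + 1)) K) (RatFun K (n + 1))).comp
          (rename (midIdx n))).toRingHom)
        ((IsFractionRing.injective (MvPolynomial (Fin (n + 1)) K) (RatFun K (n + 1))).comp
          (rename_injective _ (midIdx_injective n))) p
    rw [hp]
    exact algebraMap_rename_mem_adjoinVars K (midIdx n) p
  rw [map_div₀]
  exact div_mem (h p) (h q)

/-- An endomorphism fixing some of the variables fixes the rational functions in them. -/
lemma RatFun.map_eq_self_of_mem_adjoinVars {K : Type} [Field K] {n : ℕ} {s : Set (Fin n)}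
    (φ : RatFun K n →ₐ[K] RatFun K n) (hφ : ∀ i ∈ s, φ (RatFun.X i) = RatFun.X i)
    {a : RatFun K n} (ha : a ∈ RatFun.adjoinVars K s) : φ a = a := by
  induction ha using IntermediateField.adjoin_induction with
  | mem x hx => obtain ⟨i, hi, rfl⟩ := hx; exact hφ i hi
  | algebraMap x => exact φ.commutes x
  | add x y _ _ hx hy => rw [map_add, hx, hy]
  | mul x y _ _ hx hy => rw [map_mul, hx, hy]
  | inv x _ hx => rw [map_inv₀, hx]

lemma RatFun.algEquiv_ext {K : Type} [Field K] {n : ℕ} {φ ψ : RatFun K n ≃ₐ[K] RatFun K n}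
    (h : ∀ i, φ (RatFun.X i) = ψ (RatFun.X i)) : φ = ψ := by
  have key : ψ⁻¹ * φ = 1 := AlgEquiv.ext fun x =>
    RatFun.map_eq_self_of_mem_adjoinVars (s := Set.univ)
      ((ψ⁻¹ * φ : RatFun K n ≃ₐ[K] RatFun K n) : RatFun K n →ₐ[K] RatFun K n)
      (fun i _ => by
        change ψ.symm (φ (RatFun.X i)) = RatFun.X i
        rw [h, AlgEquiv.symm_apply_apply])
      (by rw [RatFun.adjoinVars_univ K n]; trivial)
  exact (inv_mul_eq_one.1 key).symm

/-- A family of `n` generators of `K(x₁, …, xₙ)` is the image of the variables under an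
automorphism. -/
lemma RatFun.exists_algEquiv_of_adjoin_eq_top {K : Type} [Field K] {n : ℕ} (v : Fin n → RatFun K n)
    (hv : IntermediateField.adjoin K (Set.range v) = ⊤) :
    ∃ φ : RatFun K n ≃ₐ[K] RatFun K n, ∀ i, φ (RatFun.X i) = v i := by
  have hX : IsTranscendenceBasis K (fun i : Fin n => (RatFun.X i : RatFun K n)) :=
    have : Algebra.IsAlgebraic (MvPolynomial (Fin n) K) (RatFun K n) :=
      (IsFractionRing.comap_isAlgebraic_iff (K := RatFun K n)).2 inferInstance
    (IsTranscendenceBasis.mvPolynomial (Fin n) K).algebraMap_comp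
  have : Algebra.IsAlgebraic (Algebra.adjoin K (Set.range v)) (RatFun K n) := by
    rw [← IntermediateField.isAlgebraic_adjoin_iff_top, hv]
    exact ⟨fun x => isAlgebraic_algebraMap (⟨x, trivial⟩ : (⊤ : IntermediateField K (RatFun K n)))⟩
  have hind : AlgebraicIndependent K v :=
    (Algebra.IsAlgebraic.isTranscendenceBasis_of_le_trdeg_of_finite K v
      hX.cardinalMk_eq_trdeg.le).1
  refine ⟨hind.aevalEquivField.trans
    ((IntermediateField.equivOfEq hv).trans IntermediateField.topEquiv), fun i => ?_⟩
  refine (hind.aevalEquivField_algebraMap_apply_coe (MvPolynomial.X i)).trans ?_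
  simp

/-- Scaling a variable by a nonzero rational function in the other variables is an
automorphism. -/
lemma RatFun.exists_scaling {K : Type} [Field K] {n : ℕ} (i : Fin n) {a : RatFun K n} (ha : a ≠ 0)
    (hmem : a ∈ RatFun.adjoinVars K {i}ᶜ) :
    ∃ φ : RatFun K n ≃ₐ[K] RatFun K n, φ (RatFun.X i) = a * RatFun.X i ∧
      ∀ j ≠ i, φ (RatFun.X j) = RatFun.X j := by
  let v : Fin n → RatFun K n := Function.update RatFun.X i (a * RatFun.X i)
  have hvj (j : Fin n) (hj : j ≠ i) : v j = RatFun.X j := Function.update_of_ne hj _ _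
  have hvi : v i = a * RatFun.X i := Function.update_self _ _ _
  have hmem_v (j : Fin n) : v j ∈ IntermediateField.adjoin K (Set.range v) :=
    IntermediateField.subset_adjoin _ _ ⟨j, rfl⟩
  have hne (j : Fin n) (hj : j ≠ i) :
      RatFun.X j ∈ IntermediateField.adjoin K (Set.range v) := hvj j hj ▸ hmem_v j
  have ha_v : a ∈ IntermediateField.adjoin K (Set.range v) := by
    refine IntermediateField.adjoin_le_iff.2 ?_ hmem
    rintro _ ⟨j, hj, rfl⟩
    exact hne j hj
  have hv : IntermediateField.adjoin K (Set.range v) = ⊤ := by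
    rw [eq_top_iff, ← RatFun.adjoinVars_univ, IntermediateField.adjoin_le_iff]
    rintro _ ⟨j, -, rfl⟩
    by_cases hj : j = i
    · subst hj
      have := mul_mem (inv_mem ha_v) (hmem_v j)
      rwa [hvi, inv_mul_cancel_left₀ ha] at this
    · exact hne j hj
  obtain ⟨φ, hφ⟩ := RatFun.exists_algEquiv_of_adjoin_eq_top v hv
  exact ⟨φ, (hφ i).trans hvi, fun j hj => (hφ j).trans (hvj j hj)⟩

open scoped commutatorElement in
/-- Scaling the variable `xᵢ` by a rational function not involving `xᵢ` and `xₖ` is a commutator: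
that of the scaling of `xₖ` by the same function and the scaling of `xᵢ` by `xₖ`. -/
lemma RatFun.scaling_mem_commutator {K : Type} [Field K] {n : ℕ} {i k : Fin n} (hik : i ≠ k)
    {a : RatFun K n} (ha : a ≠ 0) (hmem : a ∈ RatFun.adjoinVars K {i, k}ᶜ)
    (σ : RatFun K n ≃ₐ[K] RatFun K n) (hσi : σ (RatFun.X i) = a * RatFun.X i)
    (hσ : ∀ j ≠ i, σ (RatFun.X j) = RatFun.X j) :
    σ ∈ commutator (RatFun K n ≃ₐ[K] RatFun K n) := by
  have hX : (RatFun.X k : RatFun K n) ≠ 0 := by simp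
  obtain ⟨τ, hτk, hτ⟩ := RatFun.exists_scaling k ha
    (IntermediateField.adjoin.mono K _ _ (Set.image_mono (by simp)) hmem)
  obtain ⟨ρ, hρi, hρ⟩ := RatFun.exists_scaling (K := K) i hX
    (IntermediateField.subset_adjoin _ _ ⟨k, hik.symm, rfl⟩)
  have hτa : τ a = a := RatFun.map_eq_self_of_mem_adjoinVars (τ : RatFun K n →ₐ[K] RatFun K n)
    (s := {i, k}ᶜ) (fun j hj => hτ j fun h => hj (by simp [h])) hmem
  have key : τ * ρ = σ * (ρ * τ) := RatFun.algEquiv_ext fun j => by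
    have hσa : σ a = a := RatFun.map_eq_self_of_mem_adjoinVars (σ : RatFun K n →ₐ[K] RatFun K n)
      (s := {i, k}ᶜ) (fun j hj => hσ j fun h => hj (by simp [h])) hmem
    have hρa : ρ a = a := RatFun.map_eq_self_of_mem_adjoinVars (ρ : RatFun K n →ₐ[K] RatFun K n)
      (s := {i, k}ᶜ) (fun j hj => hρ j fun h => hj (by simp [h])) hmem
    simp only [AlgEquiv.mul_apply]
    by_cases hji : j = i
    · subst hji
      rw [hρi, map_mul, hτk, hτ j hik, hρi, map_mul, hσ k hik.symm, hσi]
      ring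
    by_cases hjk : j = k
    · subst hjk
      rw [hρ j hji, hτk, map_mul, hρa, hρ j hji, map_mul, hσa, hσ j hji]
    · rw [hρ j hji, hτ j hjk, hρ j hji, hσ j hji]
  have hcomm : σ = ⁅τ, ρ⁆ := by
    rw [commutatorElement_def, eq_mul_inv_iff_mul_eq, eq_mul_inv_iff_mul_eq, mul_assoc, key]
  rw [hcomm]
  exact Subgroup.commutator_mem_commutator (Subgroup.mem_top τ) (Subgroup.mem_top ρ)

theorem scaling_by_subfield_unit_in_commutatorSubgroup (n : ℕ) (hn : 2 ≤ n)
    (α : RatFun ℂ (n + 1)) (hα : α ≠ 0) (hmem : α ∈ (midEmb ℂ n).range)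
    (σ : RatFun ℂ (n + 1) ≃ₐ[ℂ] RatFun ℂ (n + 1))
    (hσ1 : σ (algebraMap (MvPolynomial (Fin (n+1)) ℂ) (RatFun ℂ (n + 1)) (X 0)) =
      α * algebraMap (MvPolynomial (Fin (n+1)) ℂ) (RatFun ℂ (n + 1)) (X 0))
    (hσ2 : ∀ i : Fin (n + 1), i ≠ 0 →
      σ (algebraMap (MvPolynomial (Fin (n+1)) ℂ) (RatFun ℂ (n + 1)) (X i)) =
        algebraMap (MvPolynomial (Fin (n+1)) ℂ) (RatFun ℂ (n + 1)) (X i)) :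
    σ ∈ commutator (RatFun ℂ (n + 1) ≃ₐ[ℂ] RatFun ℂ (n + 1)) ∧
    Abelianization.of σ = 1 := by
  have hcomm : σ ∈ commutator (RatFun ℂ (n + 1) ≃ₐ[ℂ] RatFun ℂ (n + 1)) := by
    have h0 : (0 : Fin (n + 1)) ≠ Fin.last n := by
      rw [Ne, Fin.ext_iff, Fin.val_zero, Fin.val_last]
      omega
    refine RatFun.scaling_mem_commutator h0 hα ?_ σ hσ1 hσ2
    obtain ⟨x, rfl⟩ := hmem
    refine IntermediateField.adjoin.mono ℂ _ _ (Set.image_mono ?_) (midEmb_mem_adjoinVars ℂ n x)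
    rintro _ ⟨j, rfl⟩
    have := j.2
    simp only [Set.mem_compl_iff, Set.mem_insert_iff, Set.mem_singleton_iff, Fin.ext_iff, midIdx,
      Fin.val_zero, Fin.val_last]
    omega
  exact ⟨hcomm, (QuotientGroup.eq_one_iff σ).2 hcomm⟩
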